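/- arXiv:2605.23299 — 2 statements merged into one kernel-verified Lean document; each statement's English description precedes it below -/
import Mathlib

section
/- Markov brothers' inequality, iterated form: if p is a real polynomial of degree at most n, then for every 1 ≤ j ≤ n, the sup-norm of the j-th derivative satisfies ‖p^{(j)}‖_{[-1,1]} ≤ n^{2j} ‖p‖_{[-1,1]}. -/
open Polynomial Real

/-- The nodes of M. Riesz's interpolation formula. -/
noncomputable def rieszNode (n k : ℕ) : ℝ := (2 * k + 1) * π / (2 * n)

/-- The absolute values of the weights in M. Riesz's interpolation formula. -/
noncomputable def rieszWeight (n k : ℕ) : ℝ := 1 / (4 * n * sin (rieszNode n k / 2) ^ 2)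

/-- The value at frequency `m` of the functional in M. Riesz's interpolation formula. -/
noncomputable def rieszMoment (n m : ℕ) : ℂ :=
  ∑ k ∈ Finset.range (2 * n),
    (-1 : ℂ) ^ k * rieszWeight n k * Complex.exp (m * rieszNode n k * Complex.I)

lemma rieszWeight_nonneg (n k : ℕ) : 0 ≤ rieszWeight n k := by
  unfold rieszWeight; positivity

lemma sin_half_rieszNode_pos {n k : ℕ} (hk : k < 2 * n) : 0 < sin (rieszNode n k / 2) := by
  have hn : (0 : ℝ) < n := by exact_mod_cast (by omega : 0 < n)
  have hk' : (k : ℝ) + 1 ≤ 2 * n := by exact_mod_cast hk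
  unfold rieszNode
  apply sin_pos_of_pos_of_lt_pi
  · positivity
  · rw [div_div, div_lt_iff₀ (by positivity)]
    nlinarith [pi_pos]

lemma rieszWeight_mul_sin_sq {n k : ℕ} (hk : k < 2 * n) :
    rieszWeight n k * sin (rieszNode n k / 2) ^ 2 = 1 / (4 * n) := by
  have hn : (n : ℝ) ≠ 0 := by exact_mod_cast (by omega : n ≠ 0)
  have := (sin_half_rieszNode_pos hk).ne'
  unfold rieszWeight
  field_simp

lemma rieszWeight_mul_cos {n k : ℕ} (hk : k < 2 * n) :
    rieszWeight n k * cos (rieszNode n k) = rieszWeight n k - 1 / (2 * n) := by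
  have h := rieszWeight_mul_sin_sq hk
  have hn : (n : ℝ) ≠ 0 := by exact_mod_cast (by omega : n ≠ 0)
  have h2 : cos (rieszNode n k) = 1 - 2 * sin (rieszNode n k / 2) ^ 2 := by
    rw [← cos_sq_add_sin_sq (rieszNode n k / 2)]
    nth_rw 1 [← mul_div_cancel₀ (rieszNode n k) (two_ne_zero' ℝ), cos_two_mul']
    ring
  rw [h2]
  have : (1 : ℝ) / (2 * n) = 2 * (1 / (4 * n)) := by field_simp; norm_num
  rw [this, ← h]; ring

lemma sum_neg_one_pow_mul_exp_rieszNode {n m : ℕ} (hm : m < n) :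
    ∑ k ∈ Finset.range (2 * n), (-1 : ℂ) ^ k * Complex.exp (m * rieszNode n k * Complex.I) = 0 := by
  have hn : (n : ℂ) ≠ 0 := by exact_mod_cast (by omega : n ≠ 0)
  have hn' : (0 : ℝ) < n := by exact_mod_cast (by omega : 0 < n)
  set r : ℂ := -Complex.exp (m * π / n * Complex.I) with hr
  have hterm (k : ℕ) : (-1 : ℂ) ^ k * Complex.exp (m * rieszNode n k * Complex.I) =
      Complex.exp (m * π / (2 * n) * Complex.I) * r ^ k := by
    rw [hr, neg_pow (Complex.exp _), ← Complex.exp_nat_mul, mul_left_comm, ← Complex.exp_add]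
    congr 2
    unfold rieszNode
    push_cast
    field_simp
    ring
  have hr1 : r ≠ 1 := by
    intro h
    have h1 : Complex.exp (((m * π / n : ℝ) : ℂ) * Complex.I) = -1 := by
      push_cast; rw [← h, hr]; ring
    have h2 : cos (m * π / n) = cos π := by
      rw [← Complex.exp_ofReal_mul_I_re, h1]; simp
    have h3 : (m * π / n : ℝ) < π := by
      rw [div_lt_iff₀ hn']
      have : (m : ℝ) < n := by exact_mod_cast hm
      nlinarith [pi_pos]
    have := cos_lt_cos_of_nonneg_of_le_pi (by positivity) le_rfl h3
    linarith
  have hr2 : r ^ (2 * n) = 1 := by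
    rw [hr, (even_two_mul n).neg_pow, ← Complex.exp_nat_mul, Complex.exp_eq_one_iff]
    exact ⟨m, by push_cast; field_simp⟩
  simp_rw [hterm, ← Finset.mul_sum, geom_sum_eq hr1, hr2]
  simp

lemma rieszMoment_second_difference {n m : ℕ} (hm : m + 1 < n) :
    rieszMoment n (m + 2) - 2 * rieszMoment n (m + 1) + rieszMoment n m = 0 := by
  have hn : (n : ℂ) ≠ 0 := by exact_mod_cast (by omega : n ≠ 0)
  have key : ∀ k ∈ Finset.range (2 * n),
      (-1 : ℂ) ^ k * rieszWeight n k * Complex.exp ((m + 2 : ℕ) * rieszNode n k * Complex.I)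
      - 2 * ((-1 : ℂ) ^ k * rieszWeight n k *
        Complex.exp ((m + 1 : ℕ) * rieszNode n k * Complex.I))
      + (-1 : ℂ) ^ k * rieszWeight n k * Complex.exp (m * rieszNode n k * Complex.I)
      = (-1 / n : ℂ) * ((-1 : ℂ) ^ k * Complex.exp ((m + 1 : ℕ) * rieszNode n k * Complex.I)) := by
    intro k hk
    have hw : (rieszWeight n k : ℂ) * Complex.cos (rieszNode n k) =
        rieszWeight n k - 1 / (2 * n) := by
      rw [← Complex.ofReal_cos, ← Complex.ofReal_mul,
        rieszWeight_mul_cos (Finset.mem_range.mp hk)]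
      push_cast; ring
    have e1 : Complex.exp ((m + 2 : ℕ) * rieszNode n k * Complex.I) =
        Complex.exp ((m + 1 : ℕ) * rieszNode n k * Complex.I) *
          Complex.exp (rieszNode n k * Complex.I) := by
      rw [← Complex.exp_add]; push_cast; ring_nf
    have e2 : Complex.exp (m * rieszNode n k * Complex.I) =
        Complex.exp ((m + 1 : ℕ) * rieszNode n k * Complex.I) *
          Complex.exp (-rieszNode n k * Complex.I) := by
      rw [← Complex.exp_add]; push_cast; ring_nf
    have e3 := Complex.two_cos (rieszNode n k)
    rw [e1, e2]
    have : (-1 / n : ℂ) = 2 * (rieszWeight n k * Complex.cos (rieszNode n k)) -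
        2 * rieszWeight n k := by
      rw [hw]; field_simp; ring
    rw [this]
    linear_combination (-(-1 : ℂ) ^ k * rieszWeight n k *
      Complex.exp ((m + 1 : ℕ) * rieszNode n k * Complex.I)) * e3
  have h0 := sum_neg_one_pow_mul_exp_rieszNode hm
  unfold rieszMoment
  rw [Finset.mul_sum, ← Finset.sum_sub_distrib, ← Finset.sum_add_distrib,
    Finset.sum_congr rfl key, ← Finset.mul_sum, h0, mul_zero]

lemma rieszMoment_zero (n : ℕ) : rieszMoment n 0 = 0 := by
  have hrefl : rieszMoment n 0 = -rieszMoment n 0 := by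
    conv_lhs => rw [rieszMoment, ← Finset.sum_range_reflect]
    rw [rieszMoment, ← Finset.sum_neg_distrib]
    refine Finset.sum_congr rfl fun k hk => ?_
    have hk := Finset.mem_range.mp hk
    have hn : (n : ℝ) ≠ 0 := by exact_mod_cast (by omega : n ≠ 0)
    have ht : rieszNode n (2 * n - 1 - k) / 2 = π - rieszNode n k / 2 := by
      have : ((2 * n - 1 - k : ℕ) : ℝ) = 2 * n - 1 - k := by
        rw [Nat.cast_sub (by omega), Nat.cast_sub (by omega)]; push_cast; ring
      unfold rieszNode
      rw [this]; field_simp; ring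
    have hw : rieszWeight n (2 * n - 1 - k) = rieszWeight n k := by
      unfold rieszWeight; rw [ht, sin_pi_sub]
    have hs : (-1 : ℂ) ^ (2 * n - 1 - k) = -(-1) ^ k := by
      have : (-1 : ℂ) ^ (2 * n - 1 - k) * (-1) ^ (k + 1) = 1 := by
        rw [← pow_add, show 2 * n - 1 - k + (k + 1) = 2 * n by omega, pow_mul]; simp
      rcases neg_one_pow_eq_or ℂ k with h | h <;> rw [pow_succ, h] at this <;> rw [h]
      · linear_combination -this
      · linear_combination this
    rw [hw, hs]; simp
  linear_combination hrefl / 2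

lemma rieszMoment_eq_mul {n m : ℕ} (hm : m ≤ n) : rieszMoment n m = m * rieszMoment n 1 := by
  induction m using Nat.twoStepInduction with
  | zero => simp [rieszMoment_zero]
  | one => simp
  | more m h0 h1 =>
    have := rieszMoment_second_difference (n := n) (m := m) (by omega)
    have h1 := h1 (by omega)
    push_cast at h1 ⊢
    linear_combination this + 2 * h1 - h0 (by omega)

lemma exp_natCast_mul_rieszNode {n : ℕ} (hn : n ≠ 0) (k : ℕ) :
    Complex.exp (n * rieszNode n k * Complex.I) = (-1) ^ k * Complex.I := by
  have hn' : (n : ℂ) ≠ 0 := by exact_mod_cast hn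
  rw [← Complex.exp_pi_mul_I, ← Complex.exp_nat_mul]
  nth_rw 3 [← Complex.exp_pi_div_two_mul_I]
  rw [← Complex.exp_add]
  congr 1
  unfold rieszNode
  push_cast
  field_simp

lemma rieszMoment_self {n : ℕ} (hn : n ≠ 0) :
    rieszMoment n n = (∑ k ∈ Finset.range (2 * n), rieszWeight n k : ℝ) * Complex.I := by
  unfold rieszMoment
  push_cast
  rw [Finset.sum_mul]
  refine Finset.sum_congr rfl fun k _ => ?_
  rw [exp_natCast_mul_rieszNode hn]
  have : (-1 : ℂ) ^ k * (-1) ^ k = 1 := by rw [← mul_pow]; simp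
  linear_combination (rieszWeight n k * Complex.I) * this

lemma im_rieszMoment_pred {n : ℕ} (hn : n ≠ 0) :
    (rieszMoment n (n - 1)).im = ∑ k ∈ Finset.range (2 * n), rieszWeight n k - 1 := by
  have key : ∀ k ∈ Finset.range (2 * n), ((-1 : ℂ) ^ k * rieszWeight n k *
      Complex.exp ((n - 1 : ℕ) * rieszNode n k * Complex.I)).im =
      rieszWeight n k - 1 / (2 * n) := by
    intro k hk
    have : Complex.exp ((n - 1 : ℕ) * rieszNode n k * Complex.I) =
        Complex.exp (n * rieszNode n k * Complex.I) *
          Complex.exp ((-rieszNode n k : ℝ) * Complex.I) := by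
      rw [← Complex.exp_add, Nat.cast_sub (by omega)]; push_cast; ring_nf
    rw [this, exp_natCast_mul_rieszNode hn, ← rieszWeight_mul_cos (Finset.mem_range.mp hk)]
    have h1 : (-1 : ℂ) ^ k * (-1) ^ k = 1 := by rw [← mul_pow]; simp
    have : (-1 : ℂ) ^ k * rieszWeight n k * ((-1) ^ k * Complex.I *
        Complex.exp ((-rieszNode n k : ℝ) * Complex.I)) =
        rieszWeight n k * (Complex.I * Complex.exp ((-rieszNode n k : ℝ) * Complex.I)) := by
      linear_combination (rieszWeight n k * (Complex.I *
        Complex.exp ((-rieszNode n k : ℝ) * Complex.I))) * h1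
    rw [this, Complex.im_ofReal_mul, Complex.I_mul_im, Complex.exp_ofReal_mul_I_re, cos_neg]
  have hn' : (n : ℝ) ≠ 0 := by exact_mod_cast hn
  rw [rieszMoment, Complex.im_sum, Finset.sum_congr rfl key, Finset.sum_sub_distrib]
  simp
  field_simp

lemma rieszMoment_one {n : ℕ} (hn : n ≠ 0) : rieszMoment n 1 = Complex.I := by
  have hn' : (n : ℝ) ≠ 0 := by exact_mod_cast hn
  have h1 := (rieszMoment_eq_mul (le_refl n)).symm.trans (rieszMoment_self hn)
  have h2 := im_rieszMoment_pred hn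
  rw [rieszMoment_eq_mul (Nat.sub_le n 1), Nat.cast_sub (by omega)] at h2
  have hre := congrArg Complex.re h1
  have him := congrArg Complex.im h1
  simp at hre him h2
  apply Complex.ext
  · simpa [hn] using hre
  · simp; linarith

lemma sum_rieszWeight {n : ℕ} (hn : n ≠ 0) :
    ∑ k ∈ Finset.range (2 * n), rieszWeight n k = n := by
  have h1 := (rieszMoment_eq_mul (le_refl n)).symm.trans (rieszMoment_self hn)
  rw [rieszMoment_one hn] at h1
  have := congrArg Complex.im h1
  simpa using this.symm

lemma sum_rieszWeight_mul_cos {n m : ℕ} (hn : n ≠ 0) (hm : m ≤ n) (θ : ℝ) :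
    ∑ k ∈ Finset.range (2 * n), (-1) ^ k * rieszWeight n k * cos (m * (θ + rieszNode n k)) =
      -(m * sin (m * θ)) := by
  have h : Complex.exp ((m * θ : ℝ) * Complex.I) * rieszMoment n m =
      Complex.exp ((m * θ : ℝ) * Complex.I) * (m * Complex.I) := by
    rw [rieszMoment_eq_mul hm, rieszMoment_one hn]
  have hre := congrArg Complex.re h
  have hR : (Complex.exp ((m * θ : ℝ) * Complex.I) * (m * Complex.I)).re =
      -(m * sin (m * θ)) := by
    rw [Complex.mul_re, Complex.exp_ofReal_mul_I_re, Complex.exp_ofReal_mul_I_im]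
    simp; ring
  rw [← hR, ← hre, rieszMoment, Finset.mul_sum, Complex.re_sum]
  refine Finset.sum_congr rfl fun k _ => ?_
  have : Complex.exp ((m * θ : ℝ) * Complex.I) * ((-1 : ℂ) ^ k * rieszWeight n k *
      Complex.exp (m * rieszNode n k * Complex.I)) =
      ((-1) ^ k * rieszWeight n k : ℝ) *
        Complex.exp ((m * (θ + rieszNode n k) : ℝ) * Complex.I) := by
    rw [mul_left_comm, ← Complex.exp_add]; push_cast; ring_nf
  rw [this, Complex.re_ofReal_mul, Complex.exp_ofReal_mul_I_re]

/-- The sequence of Chebyshev polynomials of the first kind. -/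
noncomputable def chebyshevTSequence : Polynomial.Sequence ℝ where
  elems' i := Chebyshev.T ℝ i
  degree_eq' i := by simp

/-- **M. Riesz's interpolation formula**. -/
lemma riesz_interpolation {n : ℕ} (hn : n ≠ 0) {p : ℝ[X]} (hp : p.natDegree ≤ n) (θ : ℝ) :
    ∑ k ∈ Finset.range (2 * n),
      (-1) ^ k * rieszWeight n k * p.eval (cos (θ + rieszNode n k)) =
      -((derivative p).eval (cos θ) * sin θ) := by
  have hmem : p ∈ Submodule.span ℝ (chebyshevTSequence '' Set.Iic n) := by
    rw [chebyshevTSequence.span_degreeLE fun i _ => by simp [chebyshevTSequence.ne_zero],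
      mem_degreeLE]
    exact degree_le_of_natDegree_le hp
  clear hp
  induction hmem using Submodule.span_induction with
  | mem q hq =>
    obtain ⟨m, hm, rfl⟩ := hq
    change ∑ k ∈ Finset.range (2 * n), (-1) ^ k * rieszWeight n k *
      (Chebyshev.T ℝ m).eval (cos (θ + rieszNode n k)) =
      -((derivative (Chebyshev.T ℝ m)).eval (cos θ) * sin θ)
    have hU := Chebyshev.U_real_cos θ ((m : ℤ) - 1)
    push_cast at hU
    rw [sub_add_cancel] at hU
    simp only [Chebyshev.T_real_cos, Chebyshev.T_derivative_eq_U, eval_mul, mul_assoc]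
    have h := sum_rieszWeight_mul_cos hn (Set.mem_Iic.mp hm) θ
    simp only [mul_assoc] at h
    push_cast
    rw [h, hU]
    simp
  | zero => simp
  | add q r _ _ hq hr =>
    simp only [eval_add, derivative_add, mul_add, add_mul, Finset.sum_add_distrib, hq, hr, neg_add]
  | smul c q _ hq =>
    simp only [eval_smul, derivative_smul, smul_eq_mul, mul_left_comm _ c, ← Finset.mul_sum, hq]
    ring

/-- **Bernstein's inequality**. -/
lemma abs_eval_derivative_cos_mul_sin_le {n : ℕ} (hn : n ≠ 0) {p : ℝ[X]} (hp : p.natDegree ≤ n)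
    {M : ℝ} (hM : ∀ s ∈ Set.Icc (-1 : ℝ) 1, |p.eval s| ≤ M) (θ : ℝ) :
    |(derivative p).eval (cos θ) * sin θ| ≤ n * M := by
  rw [← abs_neg, ← riesz_interpolation hn hp, ← sum_rieszWeight hn, Finset.sum_mul]
  refine (Finset.abs_sum_le_sum_abs _ _).trans (Finset.sum_le_sum fun k _ => ?_)
  rw [abs_mul, abs_mul, abs_neg_one_pow, one_mul, abs_of_nonneg (rieszWeight_nonneg n k)]
  exact mul_le_mul_of_nonneg_left (hM _ ⟨neg_one_le_cos _, cos_le_one _⟩) (rieszWeight_nonneg n k)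

/-- If a polynomial is dominated by the derivative of a nodal polynomial at its nodes, then it is
dominated by it to the right of the nodes. -/
lemma abs_eval_le_mul_eval_derivative_nodal {ι : Type*} [DecidableEq ι] {s : Finset ι} {v : ι → ℝ}
    (hvs : Set.InjOn v s) {q : ℝ[X]} (hq : q.degree < s.card) {M : ℝ}
    (h : ∀ i ∈ s, |q.eval (v i)| ≤ M * |(derivative (Lagrange.nodal s v)).eval (v i)|)
    {x : ℝ} (hx : ∀ i ∈ s, v i ≤ x) :
    |q.eval x| ≤ M * (derivative (Lagrange.nodal s v)).eval x := by
  rw [Lagrange.eq_interpolate hvs hq, Lagrange.interpolate_eq_sum, eval_finsetSum,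
    Lagrange.derivative_nodal, eval_finsetSum, Finset.mul_sum]
  refine (Finset.abs_sum_le_sum_abs _ _).trans (Finset.sum_le_sum fun i hi => ?_)
  have hi' := h i hi
  rw [Lagrange.eval_nodal_derivative_eval_node_eq hi, Lagrange.eval_nodal] at hi'
  rw [eval_mul, eval_C, ← Lagrange.nodal_eq, Lagrange.eval_nodal, abs_mul, abs_div,
    abs_of_nonneg (Finset.prod_nonneg fun j hj => sub_nonneg.2 (hx j (Finset.mem_of_mem_erase hj)))]
  refine mul_le_mul_of_nonneg_right ?_
    (Finset.prod_nonneg fun j hj => sub_nonneg.2 (hx j (Finset.mem_of_mem_erase hj)))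
  rw [div_le_iff₀]
  · exact hi'
  · rw [abs_pos, Finset.prod_ne_zero_iff]
    intro j hj
    rw [Finset.mem_erase] at hj
    exact sub_ne_zero.2 fun e => hj.1 (hvs hi hj.2 e).symm

lemma chebyshevT_eq_C_mul_nodal (n : ℕ) :
    Chebyshev.T ℝ n = C (2 ^ (n - 1)) *
      Lagrange.nodal (Finset.range n) (fun k => cos (rieszNode n k)) := by
  have hnd := Chebyshev.roots_T_real_nodup n
  have hroots : (Chebyshev.T ℝ n).roots =
      Multiset.map (fun k => cos (rieszNode n k)) (Multiset.range n) := by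
    rw [Chebyshev.roots_T_real, Finset.image_val, Finset.range_val]
    exact hnd.dedup
  have h := C_leadingCoeff_mul_prod_multiset_X_sub_C (p := Chebyshev.T ℝ n)
    (by rw [hroots]; simp)
  rw [hroots, Multiset.map_map] at h
  rw [← h, Chebyshev.leadingCoeff_T]
  simp [Lagrange.nodal_eq, Finset.prod]

/-- **Markov's inequality** to the right of the Chebyshev nodes. -/
lemma abs_eval_derivative_le_of_cos_le {n : ℕ} (hn : n ≠ 0) {p : ℝ[X]} (hp : p.natDegree ≤ n)
    {M : ℝ} (hM : ∀ s ∈ Set.Icc (-1 : ℝ) 1, |p.eval s| ≤ M) {t : ℝ}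
    (ht : cos (π / (2 * n)) ≤ t) (ht1 : t ≤ 1) :
    |(derivative p).eval t| ≤ n ^ 2 * M := by
  have hM0 : 0 ≤ M := (abs_nonneg _).trans (hM 0 (by simp))
  have hn' : (0 : ℝ) < n := by exact_mod_cast Nat.pos_of_ne_zero hn
  have hT := congrArg derivative (chebyshevT_eq_C_mul_nodal n)
  rw [derivative_C_mul] at hT
  have hTe (x : ℝ) : (derivative (Chebyshev.T ℝ n)).eval x = 2 ^ (n - 1) *
      (derivative (Lagrange.nodal (Finset.range n) (fun k => cos (rieszNode n k)))).eval x := by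
    rw [hT, eval_C_mul]
  have hinj : Set.InjOn (fun k => cos (rieszNode n k)) (Finset.range n) :=
    (Finset.range n).nodup_map_iff_injOn.mp (Chebyshev.roots_T_real_nodup n)
  have hdeg : (derivative p).degree < (Finset.range n).card := by
    rw [Finset.card_range]
    have := natDegree_derivative_le p
    exact degree_le_natDegree.trans_lt (by exact_mod_cast (by omega))
  have hnode : ∀ k ∈ Finset.range n, |(derivative p).eval (cos (rieszNode n k))| ≤
      M * 2 ^ (n - 1) * |(derivative (Lagrange.nodal (Finset.range n)
        (fun k => cos (rieszNode n k)))).eval (cos (rieszNode n k))| := by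
    intro k hk
    have hk' : (k : ℝ) + 1 ≤ n := by exact_mod_cast Finset.mem_range.mp hk
    have hs : 0 < sin (rieszNode n k) := by
      unfold rieszNode
      apply sin_pos_of_pos_of_lt_pi (by positivity)
      rw [div_lt_iff₀ (by positivity)]
      nlinarith [pi_pos]
    have hB := abs_eval_derivative_cos_mul_sin_le hn hp hM (rieszNode n k)
    have hU := Chebyshev.U_real_cos (rieszNode n k) ((n : ℤ) - 1)
    push_cast at hU
    rw [sub_add_cancel] at hU
    have hsn : |sin (n * rieszNode n k)| = 1 := by
      have : n * rieszNode n k = k * π + π / 2 := by unfold rieszNode; field_simp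
      rw [this, sin_add_pi_div_two, cos_nat_mul_pi, abs_neg_one_pow]
    have hTn : |(derivative (Chebyshev.T ℝ n)).eval (cos (rieszNode n k))| *
        sin (rieszNode n k) = n := by
      calc |(derivative (Chebyshev.T ℝ n)).eval (cos (rieszNode n k))| * sin (rieszNode n k)
          = |(derivative (Chebyshev.T ℝ n)).eval (cos (rieszNode n k)) * sin (rieszNode n k)| := by
            rw [abs_mul, abs_of_pos hs]
        _ = n := by
            rw [Chebyshev.T_derivative_eq_U, eval_mul, mul_assoc, hU, abs_mul, hsn]
            simp
    rw [hTe, abs_mul, abs_of_pos (by positivity : (0 : ℝ) < 2 ^ (n - 1))] at hTn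
    rw [abs_mul, abs_of_pos hs, ← hTn] at hB
    refine le_of_mul_le_mul_right (hB.trans_eq ?_) hs
    ring
  have hle : ∀ k ∈ Finset.range n, cos (rieszNode n k) ≤ t := by
    intro k hk
    have hk' : (k : ℝ) + 1 ≤ n := by exact_mod_cast Finset.mem_range.mp hk
    refine (cos_le_cos_of_nonneg_of_le_pi (by positivity) ?_ ?_).trans ht
    · unfold rieszNode
      rw [div_le_iff₀ (by positivity)]
      nlinarith [pi_pos]
    · unfold rieszNode
      gcongr
      nlinarith [pi_pos, mul_nonneg (Nat.cast_nonneg (α := ℝ) k) pi_pos.le]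
  have h := abs_eval_le_mul_eval_derivative_nodal hinj hdeg hnode hle
  rw [mul_assoc, ← hTe] at h
  have ht0 : -1 ≤ t := (neg_one_le_cos _).trans ht
  have hT1 := Chebyshev.abs_iterate_derivative_T_real_le n 1 (abs_le.2 ⟨ht0, ht1⟩)
  rw [Function.iterate_one, Chebyshev.derivative_T_eval_one] at hT1
  refine h.trans ?_
  rw [mul_comm]
  exact mul_le_mul_of_nonneg_right ((le_abs_self _).trans (by exact_mod_cast hT1)) hM0

/-- **Markov's inequality**. -/
lemma abs_eval_derivative_le {n : ℕ} (hn : n ≠ 0) {p : ℝ[X]} (hp : p.natDegree ≤ n)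
    {M : ℝ} (hM : ∀ s ∈ Set.Icc (-1 : ℝ) 1, |p.eval s| ≤ M) {t : ℝ}
    (ht : t ∈ Set.Icc (-1 : ℝ) 1) :
    |(derivative p).eval t| ≤ n ^ 2 * M := by
  have hn' : (0 : ℝ) < n := by exact_mod_cast Nat.pos_of_ne_zero hn
  have hn1 : (1 : ℝ) ≤ n := by exact_mod_cast Nat.one_le_iff_ne_zero.2 hn
  rcases le_total (cos (π / (2 * n))) t with h1 | h1
  · exact abs_eval_derivative_le_of_cos_le hn hp hM h1 ht.2
  rcases le_total t (-cos (π / (2 * n))) with h2 | h2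
  · have h := abs_eval_derivative_le_of_cos_le hn (p := p.comp (-X)) (M := M) (t := -t)
      (by simpa [natDegree_comp] using hp)
      (fun s hs => by simpa using hM (-s) ⟨by linarith [hs.2], by linarith [hs.1]⟩)
      (by linarith) (by linarith [ht.1])
    simpa [derivative_comp] using h
  have hsq : 1 / (n : ℝ) ≤ sin (arccos t) := by
    have hJ := mul_le_sin (x := π / (2 * n)) (by positivity)
      (div_le_div_of_nonneg_left pi_pos.le (by norm_num) (by linarith))
    have hJ' : 2 / π * (π / (2 * n)) = 1 / n := by field_simp
    rw [hJ'] at hJ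
    have : sin (π / (2 * n)) ^ 2 ≤ sin (arccos t) ^ 2 := by
      rw [sin_sq, sin_sq, cos_arccos ht.1 ht.2]
      nlinarith
    exact hJ.trans (abs_le_of_sq_le_sq' this (sin_arccos t ▸ sqrt_nonneg _)).2
  have hB := abs_eval_derivative_cos_mul_sin_le hn hp hM (arccos t)
  have hs : 0 < sin (arccos t) := (by positivity : 0 < 1 / (n : ℝ)).trans_le hsq
  rw [cos_arccos ht.1 ht.2, abs_mul, abs_of_pos hs] at hB
  have h3 : |(derivative p).eval t| * (1 / n) ≤ n * M :=
    (mul_le_mul_of_nonneg_left hsq (abs_nonneg _)).trans hB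
  rw [mul_one_div, div_le_iff₀ hn'] at h3
  linarith

/-- Iterated Markov inequality: for a real polynomial of degree at most `n` and
`1 ≤ j ≤ n`, `‖p^{(j)}‖_{[-1,1]} ≤ n^{2j} ‖p‖_{[-1,1]}`. -/
theorem iterated_markov_inequality (n : ℕ) (p : Polynomial ℝ)
    (hp : p.natDegree ≤ n) (j : ℕ) (hj1 : 1 ≤ j) (hjn : j ≤ n)
    (t : ℝ) (ht : t ∈ Set.Icc (-1 : ℝ) 1) :
    |((Polynomial.derivative^[j]) p).eval t| ≤
      (n : ℝ) ^ (2 * j) *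
        sSup ((fun s : ℝ => |p.eval s|) '' Set.Icc (-1 : ℝ) 1) := by
  have hn : n ≠ 0 := by omega
  have hbdd : BddAbove ((fun s : ℝ => |p.eval s|) '' Set.Icc (-1 : ℝ) 1) :=
    (isCompact_Icc.image p.continuous.abs).bddAbove
  clear hj1 hjn
  induction j generalizing t with
  | zero => simpa using le_csSup hbdd (Set.mem_image_of_mem _ ht)
  | succ j ih =>
    rw [Function.iterate_succ_apply', mul_add, mul_one, pow_add, mul_comm (_ ^ (2 * j)), mul_assoc]
    exact abs_eval_derivative_le hn ((natDegree_iterate_derivative p j).trans (by omega)) ih ht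
end

section
/- Assume the lower bound Λ_n > 0.5212 + (2/π) log(n+1) holds for the Lebesgue constant Λ_n of nodes x_1 < ... < x_{n+1} in (-1, 1], n > 1. Set a(n) = log(2 − (0.5212 + (2/π) log(n+1))^{-1}). If x_1 > -1 and 1 + x_1 ≤ a(n)/n², then λ_n(-1) < Λ_n, i.e. the Lebesgue function does not attain its maximum at -1. -/
open Polynomial in
/-- The iterated derivatives of the Chebyshev polynomial `T n` at `1` are at most `n ^ (2 * k)`. -/
lemma iterate_derivative_chebyshev_T_eval_one_le (n k : ℕ) :
    (derivative^[k] (Chebyshev.T ℝ n)).eval 1 ≤ ((n : ℝ) ^ 2) ^ k := by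
  induction k with
  | zero => simp
  | succ k ih =>
    have hrec := Chebyshev.iterate_derivative_T_eval_one_recurrence (R := ℝ) n k
    have h0 : 0 ≤ (derivative^[k] (Chebyshev.T ℝ n)).eval 1 :=
      (abs_nonneg _).trans (Chebyshev.abs_iterate_derivative_T_real_le n k (x := 1) (by simp))
    have h1 : 0 ≤ (derivative^[k + 1] (Chebyshev.T ℝ n)).eval 1 :=
      (abs_nonneg _).trans
        (Chebyshev.abs_iterate_derivative_T_real_le n (k + 1) (x := 1) (by simp))
    rw [pow_succ]
    push_cast at hrec
    have hk : (0 : ℝ) ≤ k := Nat.cast_nonneg k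
    nlinarith [mul_nonneg hk h1, mul_nonneg (sq_nonneg (k : ℝ)) h0,
      mul_le_mul_of_nonneg_right ih (sq_nonneg (n : ℝ))]

open Polynomial in
/-- Markov's inequality for all iterated derivatives at the endpoint `1`, in a weak form. -/
lemma abs_iterate_derivative_eval_one_le {n : ℕ} {P : ℝ[X]} (hdeg : P.degree ≤ n)
    (hP : ∀ t ∈ Set.Icc (-1 : ℝ) 1, |P.eval t| ≤ 1) (k : ℕ) :
    |(derivative^[k] P).eval 1| ≤ ((n : ℝ) ^ 2) ^ k := by
  have hT := iterate_derivative_chebyshev_T_eval_one_le n k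
  have h1 := Chebyshev.eval_iterate_derivative_le_of_forall_abs_le_one (k := k) le_rfl hdeg hP
  have h2 := Chebyshev.eval_iterate_derivative_le_of_forall_abs_le_one (P := -P) (k := k) le_rfl
    (by rwa [degree_neg]) (by simpa using hP)
  rw [iterate_derivative_neg, eval_neg] at h2
  exact abs_le.2 ⟨by linarith, by linarith⟩

open Polynomial in
/-- The increment at `1` of a polynomial bounded by `1` on `[-1, 1]`, estimated by Taylor expansion
and the endpoint Markov inequality. -/
lemma eval_one_sub_eval_le_exp {n : ℕ} {P : ℝ[X]} (hdeg : P.degree ≤ n)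
    (hP : ∀ t ∈ Set.Icc (-1 : ℝ) 1, |P.eval t| ≤ 1) {d : ℝ} (hd : 0 ≤ d) :
    P.eval 1 - P.eval (1 - d) ≤ Real.exp ((n : ℝ) ^ 2 * d) - 1 := by
  have hcoeff (k : ℕ) : |(taylor 1 P).coeff k| ≤ ((n : ℝ) ^ 2) ^ k / k.factorial := by
    have hk : (0 : ℝ) < k.factorial := by positivity
    have h := abs_iterate_derivative_eval_one_le hdeg hP k
    rw [← factorial_smul_hasseDeriv, LinearMap.smul_apply, eval_smul, ← taylor_coeff, nsmul_eq_mul,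
      abs_mul, abs_of_pos hk] at h
    rw [le_div_iff₀ hk]
    linarith
  have hexpand : P.eval (1 - d) =
      ∑ k ∈ Finset.range (n + 1), (taylor 1 P).coeff k * (-d) ^ k := by
    rw [← eval_eq_sum_range' (p := taylor 1 P), taylor_eval, neg_add_eq_sub]
    rw [natDegree_taylor]
    exact Nat.lt_succ_of_le (natDegree_le_of_degree_le hdeg)
  rw [Finset.sum_range_succ', taylor_coeff_zero, pow_zero, mul_one] at hexpand
  have hexp := Real.sum_le_exp_of_nonneg (x := (n : ℝ) ^ 2 * d) (by positivity) (n + 1)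
  rw [Finset.sum_range_succ'] at hexp
  have hterm : -∑ k ∈ Finset.range n, (taylor 1 P).coeff (k + 1) * (-d) ^ (k + 1) ≤
      ∑ k ∈ Finset.range n, ((n : ℝ) ^ 2 * d) ^ (k + 1) / (k + 1).factorial := by
    rw [← Finset.sum_neg_distrib]
    refine Finset.sum_le_sum fun k _ => (neg_le_abs _).trans ?_
    rw [abs_mul, abs_pow, abs_neg, abs_of_nonneg hd, mul_pow, mul_div_right_comm]
    gcongr
    exact hcoeff (k + 1)
  simp only [pow_zero, Nat.factorial_zero, Nat.cast_one, div_one] at hexp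
  linarith

open Polynomial in
/-- The increment at `-1` of a polynomial bounded by `M` on `[-1, 1]`. -/
lemma eval_neg_one_sub_eval_le_mul_exp {n : ℕ} {P : ℝ[X]} (hdeg : P.degree ≤ n) {M : ℝ}
    (hM : 0 < M) (hP : ∀ t ∈ Set.Icc (-1 : ℝ) 1, |P.eval t| ≤ M) {d : ℝ} (hd : 0 ≤ d) :
    P.eval (-1) - P.eval (-1 + d) ≤ M * (Real.exp ((n : ℝ) ^ 2 * d) - 1) := by
  have hQdeg : (C M⁻¹ * P.comp (-X)).degree ≤ n := by
    rw [degree_C_mul (inv_ne_zero hM.ne')]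
    refine degree_le_of_natDegree_le ?_
    rw [natDegree_comp, natDegree_neg, natDegree_X, mul_one]
    exact natDegree_le_of_degree_le hdeg
  have h := eval_one_sub_eval_le_exp hQdeg (fun t ht => by
    have := hP (-t) ⟨by linarith [ht.2], by linarith [ht.1]⟩
    rw [eval_mul, eval_C, eval_comp, eval_neg, eval_X, abs_mul, abs_of_pos (inv_pos.2 hM)]
    rwa [inv_mul_le_iff₀ hM, mul_one]) hd
  simp only [eval_mul, eval_C, eval_comp, eval_neg, eval_X, ← mul_sub] at h
  rw [inv_mul_le_iff₀ hM] at h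
  rwa [show -(1 - d) = -1 + d by ring] at h

/-- If the nodes lie in `(-1,1]`, the Lebesgue constant satisfies the Brutman-type
lower bound, and `1 + x 0 ≤ a(n)/n²` where
`a(n) = log(2 - (0.5212 + (2/π) log(n+1))⁻¹)`, then the Lebesgue function does not
attain its maximum at `-1`. -/
theorem lebesgue_max_not_at_left_endpoint (n : ℕ) (hn : 1 < n) (x : Fin (n + 1) → ℝ)
    (hx : StrictMono x) (hxI : ∀ j, x j ∈ Set.Ioc (-1 : ℝ) 1)
    (hΛ : 0.5212 + (2 / Real.pi) * Real.log (n + 1) <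
      sSup ((fun t : ℝ => ∑ j, |∏ k ∈ Finset.univ.erase j, (t - x k) / (x j - x k)|) ''
        Set.Icc (-1 : ℝ) 1))
    (hsep : 1 + x 0 ≤
      Real.log (2 - (0.5212 + (2 / Real.pi) * Real.log (n + 1))⁻¹) / (n : ℝ) ^ 2) :
    (∑ j, |∏ k ∈ Finset.univ.erase j, ((-1 : ℝ) - x k) / (x j - x k)|) <
      sSup ((fun t : ℝ => ∑ j, |∏ k ∈ Finset.univ.erase j, (t - x k) / (x j - x k)|) ''
        Set.Icc (-1 : ℝ) 1) := by
  have hlog : 0 ≤ (2 / Real.pi) * Real.log (n + 1) :=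
    mul_nonneg (by positivity) (Real.log_nonneg (by linarith [Nat.cast_nonneg (α := ℝ) n]))
  set L : ℝ := 0.5212 + (2 / Real.pi) * Real.log (n + 1) with hL
  have hL0 : 0.5212 ≤ L := by linarith
  have hLpos : 0 < L := by linarith
  set ℓ : Fin (n + 1) → ℝ → ℝ := fun j t => ∏ k ∈ Finset.univ.erase j, (t - x k) / (x j - x k)
    with hℓ
  change L < sSup ((fun t => ∑ j, |ℓ j t|) '' Set.Icc (-1 : ℝ) 1) at hΛ
  change ∑ j, |ℓ j (-1)| < sSup ((fun t => ∑ j, |ℓ j t|) '' Set.Icc (-1 : ℝ) 1)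
  set Λ : ℝ := sSup ((fun t => ∑ j, |ℓ j t|) '' Set.Icc (-1 : ℝ) 1)
  have hbound (t : ℝ) (ht : t ∈ Set.Icc (-1 : ℝ) 1) : ∑ j, |ℓ j t| ≤ Λ := by
    refine le_csSup (isCompact_Icc.bddAbove_image ?_) (Set.mem_image_of_mem _ ht)
    simp only [hℓ]
    fun_prop
  set c : Fin (n + 1) → ℝ := fun j => SignType.sign (ℓ j (-1)) with hc
  have hc1 (j) : |c j| ≤ 1 := by
    rcases lt_trichotomy (ℓ j (-1)) 0 with h | h | h <;> simp [hc, h]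
  let P : Polynomial ℝ := ∑ j, Polynomial.C (c j) * Lagrange.basis Finset.univ x j
  have hPeval (t : ℝ) : P.eval t = ∑ j, c j * ℓ j t := by
    simp only [P, hℓ, Polynomial.eval_finsetSum, Polynomial.eval_mul, Polynomial.eval_C,
      Lagrange.basis, Polynomial.eval_prod, Lagrange.basisDivisor, Polynomial.eval_sub,
      Polynomial.eval_X, div_eq_inv_mul]
  have hPdeg : P.degree ≤ n := by
    refine (Polynomial.degree_sum_le _ _).trans (Finset.sup_le fun j _ => ?_)
    rw [← Polynomial.smul_eq_C_mul]
    refine (Polynomial.degree_smul_le _ _).trans ?_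
    rw [Lagrange.degree_basis hx.injective.injOn (Finset.mem_univ j)]
    simp
  have hPbound (t : ℝ) (ht : t ∈ Set.Icc (-1 : ℝ) 1) : |P.eval t| ≤ Λ := by
    rw [hPeval]
    refine (Finset.abs_sum_le_sum_abs _ _).trans ((Finset.sum_le_sum fun j _ => ?_).trans
      (hbound t ht))
    rw [abs_mul]
    exact mul_le_of_le_one_left (abs_nonneg _) (hc1 j)
  have hPleft : P.eval (-1) = ∑ j, |ℓ j (-1)| := by
    rw [hPeval]
    exact Finset.sum_congr rfl fun j _ => sign_mul_self _
  have hPnode : P.eval (x 0) ≤ 1 := by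
    have : P.eval (x 0) = c 0 := by
      simp only [P, Polynomial.eval_finsetSum, Polynomial.eval_mul, Polynomial.eval_C]
      rw [Finset.sum_eq_single 0, Lagrange.eval_basis_self hx.injective.injOn (Finset.mem_univ 0),
        mul_one]
      · intro j _ hj
        rw [Lagrange.eval_basis_of_ne hj (Finset.mem_univ 0), mul_zero]
      · simp
    rw [this]
    exact (le_abs_self _).trans (hc1 0)
  have hΛpos : 0 < Λ := hLpos.trans hΛ
  have hincr := eval_neg_one_sub_eval_le_mul_exp hPdeg hΛpos hPbound
    (d := 1 + x 0) (by linarith [(hxI 0).1])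
  rw [neg_add_cancel_left, hPleft] at hincr
  have hInv : L⁻¹ < 2 := by
    rw [inv_lt_comm₀ hLpos two_pos]
    norm_num at hL0 ⊢
    linarith
  have hexp : Real.exp ((n : ℝ) ^ 2 * (1 + x 0)) ≤ 2 - L⁻¹ := by
    rw [← Real.le_log_iff_exp_le (by linarith), mul_comm]
    exact (le_div_iff₀ (by positivity)).1 hsep
  have hgain : 1 < Λ * L⁻¹ := by
    rw [← div_eq_mul_inv, one_lt_div hLpos]
    exact hΛ
  nlinarith [mul_le_mul_of_nonneg_left hexp hΛpos.le]
end
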